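/- Assume ℛ is nonempty. Then for every qP : Q_P, qΠ : Q_Π and S : Set Σ, the state ((qP, true, S), qΠ) is not in lfp F, the least fixed point of the full inactivity operator F. (States whose Boolean component is ⊤ are always active.) -/

import Mathlib

attribute [local instance] Classical.propDecidable

/-- States of the intersection LTA whose Boolean component is `true` are never inactive:
they are not in the least fixed point of the full inactivity operator `F`. -/
theorem keep_active
    {QP QPi A : Type*}
    (δP : QP → A → QP) (δPi : QPi → A → QPi)
    (FP : Set QP) (FPi : Set QPi)
    (D : A → Set A) (ℛ : Set (A → Set A))
    (hR : ℛ.Nonempty)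
    (F : Set ((QP × Bool × Set A) × QPi) →o Set ((QP × Bool × Set A) × QPi))
    (hF : ∀ X, F X = { p : (QP × Bool × Set A) × QPi |
      ∀ R ∈ ℛ, ((p.1.1 ∈ FP ∧ p.1.2.1 = false) → p.2 ∈ FPi) →
        ∃ a, ((δP p.1.1 a, p.1.2.1 || decide (a ∈ p.1.2.2),
               (p.1.2.2 ∪ R a) \ D a), δPi p.2 a) ∈ X }) :
    ∀ (qP : QP) (qPi : QPi) (S : Set A),
      ((qP, true, S), qPi) ∉ OrderHom.lfp F := by
  intro qP qPi S hmem
  have hle : OrderHom.lfp F ≤ {p | p.1.2.1 = false} := by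
    refine OrderHom.lfp_le F ?_
    rw [hF]
    rintro ⟨⟨q, ι, T⟩, r⟩ hp
    obtain ⟨R, hR⟩ := hR
    cases ι with
    | false => rfl
    | true =>
      obtain ⟨a, ha⟩ := hp R hR fun h => Bool.noConfusion h.2
      simp at ha
  exact Bool.noConfusion (hle hmem)
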